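/- Let n₁,n₂ ≥ 1, 1 < p < q < ∞, 0 ≤ β_i < n_i, γ_i < n_i(p-1), and β_i + (α_i+n_i)/q = (γ_i+n_i)/p for i = 1,2. Then the function f(x₁,x₂) = ∏_{i=1,2} |x_i|^{-γ_i/(p-1)} (1 + d_i |x_i|^{(n_i(p-1)-γ_i)/(n_i(p-1)) · (n_i q/p - n_i)})^{-q/(q-p)}, with d_i = (n_i(p-1)/(n_i(p-1)-γ_i))^{1/n_i}, is an extremal function: ‖𝓗_{β₁,β₂}(f)‖_{L^q(|x|^α)}/‖f‖_{L^p(|x|^γ)} equals the sharp constant C* of the weighted product-space Hardy inequality. -/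

import Mathlib

open MeasureTheory Set
open scoped ENNReal

/-- The Euler Beta function `B(z,w) = ∫₀¹ t^(z-1) (1-t)^(w-1) dt`. -/
noncomputable def betaFn (z w : ℝ) : ℝ :=
  ∫ t in Ioo (0 : ℝ) 1, t ^ (z - 1) * (1 - t) ^ (w - 1)

/-- Surface area `|S^{n-1}| = 2 π^{n/2} / Γ(n/2)` of the unit sphere. -/
noncomputable def omegaN (n : ℕ) : ℝ :=
  2 * Real.pi ^ ((n : ℝ) / 2) / Real.Gamma ((n : ℝ) / 2)

/-- The two-fold fractional Hardy operator `𝓗_{β₁,β₂}` on `ℝ^{n₁} × ℝ^{n₂}`. -/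
noncomputable def prodFracHardy₂ (n₁ n₂ : ℕ) (β₁ β₂ : ℝ)
    (f : EuclideanSpace ℝ (Fin n₁) × EuclideanSpace ℝ (Fin n₂) → ℝ≥0∞)
    (x : EuclideanSpace ℝ (Fin n₁) × EuclideanSpace ℝ (Fin n₂)) : ℝ≥0∞ :=
  (volume (Metric.ball (0 : EuclideanSpace ℝ (Fin n₁)) ‖x.1‖)) ^ (β₁ / (n₁ : ℝ) - 1) *
  (volume (Metric.ball (0 : EuclideanSpace ℝ (Fin n₂)) ‖x.2‖)) ^ (β₂ / (n₂ : ℝ) - 1) *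
    ∫⁻ y in (Metric.ball (0 : EuclideanSpace ℝ (Fin n₁)) ‖x.1‖) ×ˢ
        (Metric.ball (0 : EuclideanSpace ℝ (Fin n₂)) ‖x.2‖), f y

/-- The sharp constant for the weighted product-space Hardy inequality (single factor). -/
noncomputable def sharpFactor (n : ℕ) (β γ p q : ℝ) : ℝ :=
  (omegaN n) ^ (1 / q - 1 / p + β / n) * (n : ℝ) ^ (1 / p - 1 / q - β / n) *
    ((n * (p - 1)) / (n * (p - 1) - γ)) ^ ((1 - 1 / p) + 1 / q) *
    ((p / (p - 1)) / q) ^ (1 / q) *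
    ((p / (q - p)) * betaFn (p / (q - p)) (p * q / ((q / (q - 1)) * (q - p)))) ^ (1 / q - 1 / p)

/-- Integration of radial functions in polar coordinates. -/
lemma lintegral_comp_norm_eq {n : ℕ} (hn : 1 ≤ n) {F : ℝ → ℝ≥0∞} (hF : Measurable F) :
    ∫⁻ x : EuclideanSpace ℝ (Fin n), F ‖x‖ =
      ENNReal.ofReal (omegaN n) *
        ∫⁻ r in Ioi (0 : ℝ), ENNReal.ofReal (r ^ ((n : ℝ) - 1)) * F r := by
  have : Nonempty (Fin n) := ⟨⟨0, hn⟩⟩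
  have hsphere : (volume : Measure (EuclideanSpace ℝ (Fin n))).toSphere univ =
      ENNReal.ofReal (omegaN n) := by
    have hn0 : (0 : ℝ) < n := by exact_mod_cast hn
    rw [Measure.toSphere_apply_univ, EuclideanSpace.volume_ball, finrank_euclideanSpace,
      Fintype.card_fin, ENNReal.ofReal_one, one_pow, one_mul, ← ENNReal.ofReal_natCast,
      ← ENNReal.ofReal_mul hn0.le, omegaN, Real.Gamma_add_one (by positivity),
      Real.sqrt_eq_rpow, ← Real.rpow_natCast, ← Real.rpow_mul Real.pi_pos.le]
    congr 1
    have := (Real.Gamma_pos_of_pos (half_pos hn0)).ne'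
    rw [show 1 / 2 * (n : ℝ) = n / 2 by ring]
    field_simp
  calc ∫⁻ x : EuclideanSpace ℝ (Fin n), F ‖x‖
      = ∫⁻ x : ({(0)}ᶜ : Set (EuclideanSpace ℝ (Fin n))), F ‖x.1‖
          ∂(volume.comap Subtype.val) := by
        rw [lintegral_subtype_comap (measurableSet_singleton _).compl fun x ↦ F ‖x‖,
          restrict_compl_singleton]
    _ = ∫⁻ x, F x.2 ∂(volume : Measure (EuclideanSpace ℝ (Fin n))).toSphere.prod
          (.volumeIoiPow (n - 1)) := by
        have h := (Measure.measurePreserving_homeomorphUnitSphereProd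
          (volume : Measure (EuclideanSpace ℝ (Fin n)))).lintegral_comp_emb
          (Homeomorph.measurableEmbedding _) (F ∘ Subtype.val ∘ Prod.snd)
        simpa using h
    _ = ENNReal.ofReal (omegaN n) * ∫⁻ r : Ioi (0 : ℝ), F r ∂.volumeIoiPow (n - 1) := by
        rw [lintegral_prod _ (by fun_prop)]
        simp only [lintegral_const, hsphere, mul_comm]
    _ = _ := by
        congr 1
        rw [Measure.volumeIoiPow, lintegral_withDensity_eq_lintegral_mul _ (by fun_prop)
          (by fun_prop)]
        simp only [Pi.mul_apply]
        rw [lintegral_subtype_comap measurableSet_Ioi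
          fun r : ℝ ↦ ENNReal.ofReal (r ^ (n - 1)) * F r]
        refine setLIntegral_congr_fun measurableSet_Ioi fun r _ ↦ ?_
        simp only [← Real.rpow_natCast, Nat.cast_sub hn, Nat.cast_one]

lemma lintegral_beta {a b : ℝ} (ha : 0 < a) (hb : 0 < b) :
    ∫⁻ t in Ioo (0 : ℝ) 1, ENNReal.ofReal (t ^ (a - 1) * (1 - t) ^ (b - 1)) =
      ENNReal.ofReal (ProbabilityTheory.beta a b) := by
  have hB := ProbabilityTheory.beta_pos ha hb
  have h := ProbabilityTheory.lintegral_betaPDF_eq_one ha hb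
  simp_rw [ProbabilityTheory.lintegral_betaPDF, mul_assoc,
    ENNReal.ofReal_mul (one_div_pos.2 hB).le] at h
  rw [lintegral_const_mul _ (by fun_prop), one_div, ENNReal.ofReal_inv_of_pos hB] at h
  have hB0 : ENNReal.ofReal (ProbabilityTheory.beta a b) ≠ 0 := (ENNReal.ofReal_pos.2 hB).ne'
  rw [← mul_one (ENNReal.ofReal _), ← h, ← mul_assoc,
    ENNReal.mul_inv_cancel hB0 ENNReal.ofReal_ne_top, one_mul]

lemma betaFn_eq_beta {a b : ℝ} (ha : 0 < a) (hb : 0 < b) :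
    betaFn a b = ProbabilityTheory.beta a b := by
  rw [betaFn, integral_eq_lintegral_of_nonneg_ae, lintegral_beta ha hb,
    ENNReal.toReal_ofReal (ProbabilityTheory.beta_pos ha hb).le]
  · refine ae_restrict_of_forall_mem measurableSet_Ioo fun t ht ↦ ?_
    exact mul_nonneg (Real.rpow_nonneg ht.1.le _) (Real.rpow_nonneg (by linarith [ht.2]) _)
  · exact Measurable.aestronglyMeasurable (by fun_prop)

lemma lintegral_rpow_mul_one_add_rpow {a b d s : ℝ} (ha : 0 < a) (hb : 0 < b) (hd : 0 < d)
    (hs : 0 < s) :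
    ∫⁻ r in Ioi (0 : ℝ), ENNReal.ofReal (r ^ (s * a - 1) * (1 + d * r ^ s) ^ (-(a + b))) =
      ENNReal.ofReal (s⁻¹ * d ^ (-a) * ProbabilityTheory.beta a b) := by
  let φ : ℝ → ℝ := fun r ↦ d * r ^ s / (1 + d * r ^ s)
  have hpos : ∀ r ∈ Ioi (0 : ℝ), 0 < d * r ^ s := fun r hr ↦
    mul_pos hd (Real.rpow_pos_of_pos hr _)
  have himage : φ '' Ioi 0 = Ioo 0 1 := by
    ext t
    constructor
    · rintro ⟨r, hr, rfl⟩
      have := hpos r hr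
      exact ⟨by positivity, (div_lt_one (by positivity)).2 (by linarith)⟩
    · rintro ⟨h0, h1⟩
      have h1' : 0 < 1 - t := by linarith
      have hv : 0 < t / (1 - t) / d := by positivity
      refine ⟨(t / (1 - t) / d) ^ s⁻¹, Real.rpow_pos_of_pos hv _, ?_⟩
      simp only [φ]
      rw [Real.rpow_inv_rpow hv.le hs.ne']
      field_simp
      ring
  have hinj : InjOn φ (Ioi 0) := by
    intro x hx y hy hxy
    have h1 := hpos x hx
    have h2 := hpos y hy
    simp only [φ] at hxy
    rw [div_eq_div_iff (by positivity) (by positivity)] at hxy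
    have h3 : x ^ s = y ^ s := mul_left_cancel₀ hd.ne' (by linarith)
    exact (Real.rpow_left_inj (le_of_lt hx) (le_of_lt hy) hs.ne').1 h3
  have hderiv : ∀ r ∈ Ioi (0 : ℝ), HasDerivWithinAt φ
      (d * (s * r ^ (s - 1)) / (1 + d * r ^ s) ^ 2) (Ioi 0) r := by
    intro r hr
    have h1 := hpos r hr
    have hp : HasDerivAt (fun r : ℝ ↦ d * r ^ s) (d * (s * r ^ (s - 1))) r :=
      (Real.hasDerivAt_rpow_const (Or.inl (ne_of_gt hr))).const_mul d
    convert! (hp.div (hp.const_add 1) (by positivity)).hasDerivWithinAt using 1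
    ring
  have hcv := lintegral_image_eq_lintegral_abs_deriv_mul measurableSet_Ioi hderiv hinj
    (fun t ↦ ENNReal.ofReal (t ^ (a - 1) * (1 - t) ^ (b - 1)))
  rw [himage, lintegral_beta ha hb] at hcv
  rw [ENNReal.ofReal_mul (by positivity), hcv, ← lintegral_const_mul _ (by fun_prop)]
  refine setLIntegral_congr_fun measurableSet_Ioi fun r hr ↦ ?_
  have h1 := hpos r hr
  have hr0 : (0 : ℝ) < r := hr
  have h2 : 0 < 1 + d * r ^ s := by positivity
  rw [← ENNReal.ofReal_mul (abs_nonneg _), ← ENNReal.ofReal_mul (by positivity),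
    abs_of_nonneg (by positivity)]
  congr 1
  have e1 : 1 - φ r = (1 + d * r ^ s)⁻¹ := by
    simp only [φ]
    field_simp
    ring
  rw [e1]
  simp only [φ]
  rw [Real.div_rpow h1.le h2.le, Real.inv_rpow h2.le, ← Real.rpow_neg h2.le,
    Real.mul_rpow hd.le (by positivity), ← Real.rpow_mul hr0.le]
  rw [show s * a - 1 = s * (a - 1) + (s - 1) by ring, Real.rpow_add hr0,
    show -(a + b) = -(b - 1) - (a - 1) - (2 : ℕ) by push_cast; ring, Real.rpow_sub h2,
    Real.rpow_sub h2, Real.rpow_natCast, show -a = -(a - 1) - 1 by ring,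
    Real.rpow_sub hd, Real.rpow_one, Real.rpow_neg hd.le (a - 1)]
  have := Real.rpow_pos_of_pos hd (a - 1)
  field_simp

lemma lintegral_Ioo_rpow_mul_one_add_rpow {l k d r : ℝ} (hl : 0 < l) (hk : 0 < k) (hd : 0 < d)
    (hr : 0 ≤ r) :
    ∫⁻ t in Ioo (0 : ℝ) r,
        ENNReal.ofReal (t ^ (l - 1) * (1 + d * t ^ (l * k)) ^ (-(1 / k + 1))) =
      ENNReal.ofReal (r ^ l / l * (1 + d * r ^ (l * k)) ^ (-(1 / k))) := by
  let G : ℝ → ℝ := fun t ↦ t ^ l / l * (1 + d * t ^ (l * k)) ^ (-(1 / k))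
  have hpos : ∀ t : ℝ, 0 ≤ t → 0 < 1 + d * t ^ (l * k) := fun t ht ↦ by positivity
  have hcont : ContinuousOn G (Icc 0 r) := by
    refine ContinuousOn.mul (ContinuousOn.div_const ?_ _) (ContinuousOn.rpow_const
      (continuousOn_const.add (continuousOn_const.mul ?_)) fun t ht ↦ Or.inl (hpos t ht.1).ne')
    · exact (Real.continuous_rpow_const hl.le).continuousOn
    · exact (Real.continuous_rpow_const (by positivity)).continuousOn
  have hderiv : ∀ t ∈ Ioo 0 r, HasDerivAt G
      (t ^ (l - 1) * (1 + d * t ^ (l * k)) ^ (-(1 / k + 1))) t := by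
    intro t ht
    have ht0 : t ≠ 0 := ht.1.ne'
    have h1 := hpos t ht.1.le
    have h2 : HasDerivAt (fun t : ℝ ↦ 1 + d * t ^ (l * k))
        (d * (l * k * t ^ (l * k - 1))) t :=
      ((Real.hasDerivAt_rpow_const (Or.inl ht0)).const_mul d).const_add 1
    convert! ((Real.hasDerivAt_rpow_const (p := l) (Or.inl ht0)).div_const l).mul
      (h2.rpow_const (p := -(1 / k)) (Or.inl h1.ne')) using 1
    rw [show -(1 / k + 1) = -(1 / k) - 1 by ring, Real.rpow_sub_one h1.ne',
      Real.rpow_sub_one ht0, Real.rpow_sub_one ht0]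
    field_simp
    ring
  have hnonneg : ∀ t ∈ Ioo 0 r, 0 ≤ t ^ (l - 1) * (1 + d * t ^ (l * k)) ^ (-(1 / k + 1)) :=
    fun t ht ↦ mul_nonneg (Real.rpow_nonneg ht.1.le _) (Real.rpow_nonneg (hpos t ht.1.le).le _)
  have hint := intervalIntegral.integrableOn_deriv_of_nonneg hcont hderiv hnonneg
  have hFTC := intervalIntegral.integral_eq_sub_of_hasDerivAt_of_le hr hcont hderiv
    ((intervalIntegrable_iff_integrableOn_Ioc_of_le hr).2 hint)
  rw [← ofReal_integral_eq_lintegral_ofReal (hint.mono_set Ioo_subset_Ioc_self)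
    (ae_restrict_of_forall_mem measurableSet_Ioo hnonneg), ← integral_Ioc_eq_integral_Ioo,
    ← intervalIntegral.integral_of_le hr, hFTC]
  simp [G, Real.zero_rpow hl.ne']

lemma beta_add_one_left {a b : ℝ} (ha : 0 < a) (hb : 0 < b) :
    ProbabilityTheory.beta (a + 1) b = a / b * ProbabilityTheory.beta a (b + 1) := by
  rw [ProbabilityTheory.beta, ProbabilityTheory.beta, Real.Gamma_add_one ha.ne',
    Real.Gamma_add_one hb.ne', show a + 1 + b = a + (b + 1) by ring]
  field_simp

lemma omegaN_pos {n : ℕ} (hn : 1 ≤ n) : 0 < omegaN n := by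
  have hn0 : (0 : ℝ) < n := by exact_mod_cast hn
  have := Real.Gamma_pos_of_pos (half_pos hn0)
  have := Real.pi_pos
  unfold omegaN
  positivity

/-- Integration of radial functions over a ball in polar coordinates. -/
lemma setLIntegral_ball_comp_norm_eq {n : ℕ} (hn : 1 ≤ n) {F : ℝ → ℝ≥0∞} (hF : Measurable F)
    (R : ℝ) :
    ∫⁻ x in Metric.ball (0 : EuclideanSpace ℝ (Fin n)) R, F ‖x‖ =
      ENNReal.ofReal (omegaN n) *
        ∫⁻ r in Ioo (0 : ℝ) R, ENNReal.ofReal (r ^ ((n : ℝ) - 1)) * F r := by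
  have h := lintegral_comp_norm_eq hn (hF.indicator (measurableSet_Iio (a := R)))
  have h1 : ∀ x : EuclideanSpace ℝ (Fin n), (Iio R).indicator F ‖x‖ =
      (Metric.ball (0 : EuclideanSpace ℝ (Fin n)) R).indicator (fun x ↦ F ‖x‖) x := by
    intro x
    simp [indicator]
  have h2 : ∀ r : ℝ, ENNReal.ofReal (r ^ ((n : ℝ) - 1)) * (Iio R).indicator F r =
      (Iio R).indicator (fun r ↦ ENNReal.ofReal (r ^ ((n : ℝ) - 1)) * F r) r := by
    intro r
    by_cases hr : r < R <;> simp [hr]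
  simp_rw [h1, h2] at h
  rwa [lintegral_indicator measurableSet_ball, setLIntegral_indicator measurableSet_Iio,
    inter_comm, Ioi_inter_Iio] at h

lemma volume_ball_zero_eq {n : ℕ} (hn : 1 ≤ n) {R : ℝ} (hR : 0 ≤ R) :
    volume (Metric.ball (0 : EuclideanSpace ℝ (Fin n)) R) =
      ENNReal.ofReal (omegaN n / n * R ^ (n : ℝ)) := by
  have hn0 : (0 : ℝ) < n := by exact_mod_cast hn
  have h := setLIntegral_ball_comp_norm_eq hn (F := fun _ ↦ 1) measurable_const R
  simp only [mul_one, setLIntegral_one] at h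
  have hint : IntervalIntegrable (fun r : ℝ ↦ r ^ ((n : ℝ) - 1)) volume 0 R :=
    intervalIntegral.intervalIntegrable_rpow' (by linarith)
  rw [h, Measure.restrict_congr_set Ioo_ae_eq_Ioc, ← ofReal_integral_eq_lintegral_ofReal hint.1
    (ae_restrict_of_forall_mem measurableSet_Ioc fun r hr ↦ Real.rpow_nonneg hr.1.le _),
    ← intervalIntegral.integral_of_le hR, integral_rpow (Or.inl (by linarith)),
    ← ENNReal.ofReal_mul (omegaN_pos hn).le, sub_add_cancel, Real.zero_rpow hn0.ne']
  congr 1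
  ring

lemma lintegral_norm_rpow_mul_one_add_norm_rpow {n : ℕ} (hn : 1 ≤ n) {a b c d s : ℝ}
    (ha : 0 < a) (hb : 0 < b) (hd : 0 < d) (hs : 0 < s) (hc : c + n = s * a)
    {F : ℝ → ℝ≥0∞} (hF : Measurable F)
    (hFr : ∀ r, 0 < r → F r = ENNReal.ofReal (r ^ c * (1 + d * r ^ s) ^ (-(a + b)))) :
    ∫⁻ x : EuclideanSpace ℝ (Fin n), F ‖x‖ =
      ENNReal.ofReal (omegaN n * (s⁻¹ * d ^ (-a) * ProbabilityTheory.beta a b)) := by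
  rw [lintegral_comp_norm_eq hn hF, ENNReal.ofReal_mul (omegaN_pos hn).le,
    ← lintegral_rpow_mul_one_add_rpow ha hb hd hs]
  congr 1
  refine setLIntegral_congr_fun measurableSet_Ioi fun r (hr : 0 < r) ↦ ?_
  rw [hFr r hr, ← ENNReal.ofReal_mul (by positivity), ← mul_assoc, ← Real.rpow_add hr,
    show (n : ℝ) - 1 + c = s * a - 1 by linarith]

/-- The fractional Hardy operator on `ℝⁿ`. -/
noncomputable def fracHardy (n : ℕ) (β : ℝ) (g : EuclideanSpace ℝ (Fin n) → ℝ≥0∞)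
    (x : EuclideanSpace ℝ (Fin n)) : ℝ≥0∞ :=
  volume (Metric.ball (0 : EuclideanSpace ℝ (Fin n)) ‖x‖) ^ (β / (n : ℝ) - 1) *
    ∫⁻ y in Metric.ball (0 : EuclideanSpace ℝ (Fin n)) ‖x‖, g y

lemma measurable_fracHardy (n : ℕ) (β : ℝ) (g : EuclideanSpace ℝ (Fin n) → ℝ≥0∞) :
    Measurable (fracHardy n β g) := by
  have h1 : Monotone fun r : ℝ ↦ volume (Metric.ball (0 : EuclideanSpace ℝ (Fin n)) r) :=
    fun r s hrs ↦ measure_mono (Metric.ball_subset_ball hrs)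
  have h2 : Monotone fun r : ℝ ↦ ∫⁻ y in Metric.ball (0 : EuclideanSpace ℝ (Fin n)) r, g y :=
    fun r s hrs ↦ lintegral_mono_set (Metric.ball_subset_ball hrs)
  exact ((h1.measurable.comp measurable_norm).pow_const _).mul (h2.measurable.comp measurable_norm)

lemma prodFracHardy₂_mul {n₁ n₂ : ℕ} (β₁ β₂ : ℝ)
    {g₁ : EuclideanSpace ℝ (Fin n₁) → ℝ≥0∞} {g₂ : EuclideanSpace ℝ (Fin n₂) → ℝ≥0∞}
    (hg₁ : Measurable g₁) (hg₂ : Measurable g₂)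
    (x : EuclideanSpace ℝ (Fin n₁) × EuclideanSpace ℝ (Fin n₂)) :
    prodFracHardy₂ n₁ n₂ β₁ β₂ (fun y ↦ g₁ y.1 * g₂ y.2) x =
      fracHardy n₁ β₁ g₁ x.1 * fracHardy n₂ β₂ g₂ x.2 := by
  rw [prodFracHardy₂, fracHardy, fracHardy, Measure.volume_eq_prod, ← Measure.prod_restrict,
    lintegral_prod_mul hg₁.aemeasurable hg₂.aemeasurable]
  ring

lemma fracHardy_norm_rpow_mul_one_add_norm_rpow {n : ℕ} (hn : 1 ≤ n) (β : ℝ) {l k d : ℝ}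
    (hl : 0 < l) (hk : 0 < k) (hd : 0 < d) {x : EuclideanSpace ℝ (Fin n)} (hx : x ≠ 0) :
    fracHardy n β (fun y ↦ ENNReal.ofReal
      (‖y‖ ^ (l - n) * (1 + d * ‖y‖ ^ (l * k)) ^ (-(1 / k + 1)))) x =
      ENNReal.ofReal ((omegaN n / n) ^ (β / n - 1) * (omegaN n / l) *
        (‖x‖ ^ (β - n + l) * (1 + d * ‖x‖ ^ (l * k)) ^ (-(1 / k)))) := by
  have hn0 : (0 : ℝ) < n := by exact_mod_cast hn
  have hω := omegaN_pos hn
  have hx0 : 0 < ‖x‖ := norm_pos_iff.2 hx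
  rw [fracHardy, volume_ball_zero_eq hn hx0.le, ENNReal.ofReal_rpow_of_pos (by positivity),
    setLIntegral_ball_comp_norm_eq hn (F := fun r ↦ ENNReal.ofReal
      (r ^ (l - n) * (1 + d * r ^ (l * k)) ^ (-(1 / k + 1)))) (by fun_prop)]
  have hcongr : ∫⁻ r in Ioo (0 : ℝ) ‖x‖, ENNReal.ofReal (r ^ ((n : ℝ) - 1)) * ENNReal.ofReal
        (r ^ (l - n) * (1 + d * r ^ (l * k)) ^ (-(1 / k + 1))) =
      ∫⁻ r in Ioo (0 : ℝ) ‖x‖, ENNReal.ofReal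
        (r ^ (l - 1) * (1 + d * r ^ (l * k)) ^ (-(1 / k + 1))) := by
    refine setLIntegral_congr_fun measurableSet_Ioo fun r hr ↦ ?_
    have hr0 : 0 < r := hr.1
    rw [← ENNReal.ofReal_mul (by positivity), ← mul_assoc, ← Real.rpow_add hr0,
      show (n : ℝ) - 1 + (l - n) = l - 1 by ring]
  rw [hcongr, lintegral_Ioo_rpow_mul_one_add_rpow hl hk hd hx0.le, ← ENNReal.ofReal_mul hω.le,
    ← ENNReal.ofReal_mul (by positivity), Real.mul_rpow (by positivity) (by positivity),
    ← Real.rpow_mul hx0.le, Real.rpow_add hx0, show n * (β / n - 1) = β - n by field_simp]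
  congr 1
  ring

/-- The radial profile of the extremal function of the weighted Hardy inequality on `ℝⁿ`. -/
noncomputable def hardyExtremalProfile (n : ℕ) (γ p q r : ℝ) : ℝ :=
  r ^ (-γ / (p - 1)) *
    (1 + ((n * (p - 1)) / (n * (p - 1) - γ)) ^ (1 / (n : ℝ)) *
      r ^ (((n * (p - 1) - γ) / (n * (p - 1))) * ((n : ℝ) * q / p - n))) ^ (-(q / (q - p)))

lemma sharpFactor_pos {n : ℕ} (hn : 1 ≤ n) {β γ p q : ℝ} (hp : 1 < p) (hpq : p < q)
    (hγ : γ < n * (p - 1)) : 0 < sharpFactor n β γ p q := by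
  have hn0 : (0 : ℝ) < n := by exact_mod_cast hn
  have hω := omegaN_pos hn
  have h1 : 0 < p - 1 := by linarith
  have h2 : 0 < q - p := by linarith
  have h3 : 0 < q - 1 := by linarith
  have h4 : 0 < n * (p - 1) - γ := by linarith
  have h5 : 0 < q := by linarith
  have h6 : 0 < p := by linarith
  have hB : 0 < betaFn (p / (q - p)) (p * q / ((q / (q - 1)) * (q - p))) := by
    rw [betaFn_eq_beta (by positivity) (by positivity)]
    exact ProbabilityTheory.beta_pos (by positivity) (by positivity)
  unfold sharpFactor
  positivity

lemma fracHardy_hardyExtremalProfile {n : ℕ} (hn : 1 ≤ n) {α β γ p q : ℝ} (hp : 1 < p)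
    (hpq : p < q) (hγ : γ < n * (p - 1)) (hscal : β + (α + n) / q = (γ + n) / p) :
    (∫⁻ x, fracHardy n β (fun y ↦ ENNReal.ofReal (hardyExtremalProfile n γ p q ‖y‖)) x ^ q *
        ENNReal.ofReal (‖x‖ ^ α)) ^ (1 / q) =
      ENNReal.ofReal (sharpFactor n β γ p q) *
        (∫⁻ x : EuclideanSpace ℝ (Fin n), ENNReal.ofReal (hardyExtremalProfile n γ p q ‖x‖) ^ p *
          ENNReal.ofReal (‖x‖ ^ γ)) ^ (1 / p) := by
  have hn0 : (0 : ℝ) < n := by exact_mod_cast hn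
  have : Nonempty (Fin n) := ⟨⟨0, hn⟩⟩
  have hω := omegaN_pos hn
  have hp1 : 0 < p - 1 := by linarith
  have hqp : 0 < q - p := by linarith
  have hq1 : 0 < q - 1 := by linarith
  have hnγ : 0 < n * (p - 1) - γ := by linarith
  have hq0 : 0 < q := by linarith
  have hp0 : 0 < p := by linarith
  obtain ⟨l, hl⟩ : ∃ l, l = (n * (p - 1) - γ) / (p - 1) := ⟨_, rfl⟩
  obtain ⟨k, hk⟩ : ∃ k, k = (q - p) / p := ⟨_, rfl⟩
  obtain ⟨d, hd⟩ : ∃ d, d = (n / l) ^ (1 / (n : ℝ)) := ⟨_, rfl⟩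
  have hl0 : 0 < l := by rw [hl]; positivity
  have hk0 : 0 < k := by rw [hk]; positivity
  have hd0 : 0 < d := by rw [hd]; positivity
  have hnl : n * (p - 1) / (n * (p - 1) - γ) = n / l := by
    rw [hl]
    field_simp
  have hγl : γ = (n - l) * (p - 1) := by
    rw [hl]
    field_simp
    ring
  have hqk : q = p * (k + 1) := by
    rw [hk]
    field_simp
    ring
  have hprofile : ∀ r, hardyExtremalProfile n γ p q r =
      r ^ (l - n) * (1 + d * r ^ (l * k)) ^ (-(1 / k + 1)) := by
    intro r
    have e1 : -γ / (p - 1) = l - n := by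
      rw [hl]
      field_simp
      ring
    have e2 : (n * (p - 1) - γ) / (n * (p - 1)) * (n * q / p - n) = l * k := by
      rw [hl, hk]
      field_simp
    have e3 : q / (q - p) = 1 / k + 1 := by
      rw [hk]
      field_simp
      ring
    rw [hardyExtremalProfile, e1, e2, e3, hnl, hd]
  have hb1 : 0 < q / k - 1 / k - 1 := by
    have : q / k - 1 / k - 1 = q * (p - 1) / (q - p) := by
      rw [hk]
      field_simp
      ring
    rw [this]
    positivity
  have hscal' : α = l * (k + 1) - n - (β - n + l) * q := by
    have h1 : (α + n) / q * q = α + n := div_mul_cancel₀ _ hq0.ne'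
    have h2 : (γ + n) / p * q = (γ + n) * (k + 1) := by
      rw [hqk]
      field_simp
    have h3 : α + n = (γ + n) * (k + 1) - β * q := by
      rw [← h1, ← h2, ← hscal]
      ring
    rw [eq_sub_of_add_eq h3, hγl, hqk]
    ring
  obtain ⟨C, hC⟩ : ∃ C, C = (omegaN n / n) ^ (β / n - 1) * (omegaN n / l) := ⟨_, rfl⟩
  have hC0 : 0 < C := by rw [hC]; positivity
  have hLHS : ∫⁻ x, fracHardy n β (fun y ↦ ENNReal.ofReal (hardyExtremalProfile n γ p q ‖y‖)) x ^ q *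
        ENNReal.ofReal (‖x‖ ^ α) =
      ENNReal.ofReal (C ^ q * (omegaN n * ((l * k)⁻¹ * d ^ (-(1 / k + 1)) *
        ProbabilityTheory.beta (1 / k + 1) (q / k - 1 / k - 1)))) := by
    rw [ENNReal.ofReal_mul (by positivity), ← lintegral_norm_rpow_mul_one_add_norm_rpow hn
      (c := (β - n + l) * q + α) (F := fun r ↦ ENNReal.ofReal
        (r ^ ((β - n + l) * q + α) * (1 + d * r ^ (l * k)) ^ (-(q / k)))) (by positivity) hb1 hd0
      (by positivity) (by rw [hscal']; field_simp; ring) (by fun_prop)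
      (fun r _ ↦ by rw [show 1 / k + 1 + (q / k - 1 / k - 1) = q / k by ring]),
      ← lintegral_const_mul _ (by fun_prop)]
    refine lintegral_congr_ae ?_
    filter_upwards [compl_mem_ae_iff.2 (measure_singleton (0 : EuclideanSpace ℝ (Fin n)))]
      with x hx
    have hx0 : 0 < ‖x‖ := norm_pos_iff.2 hx
    simp only [hprofile]
    rw [fracHardy_norm_rpow_mul_one_add_norm_rpow hn β hl0 hk0 hd0 hx, ← hC,
      ENNReal.ofReal_rpow_of_pos (by positivity), ← ENNReal.ofReal_mul (by positivity),
      ← ENNReal.ofReal_mul (by positivity), Real.mul_rpow hC0.le (by positivity),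
      Real.mul_rpow (by positivity) (by positivity), ← Real.rpow_mul hx0.le,
      ← Real.rpow_mul (by positivity), Real.rpow_add hx0,
      show -(1 / k) * q = -(q / k) by ring]
    congr 1
    ring
  have hRHS : ∫⁻ x : EuclideanSpace ℝ (Fin n),
        ENNReal.ofReal (hardyExtremalProfile n γ p q ‖x‖) ^ p * ENNReal.ofReal (‖x‖ ^ γ) =
      ENNReal.ofReal (omegaN n * ((l * k)⁻¹ * d ^ (-(1 / k)) *
        ProbabilityTheory.beta (1 / k) (q / k - 1 / k - 1 + 1))) := by
    simp only [hprofile]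
    refine lintegral_norm_rpow_mul_one_add_norm_rpow hn
      (c := (l - n) * p + γ) (F := fun r ↦ ENNReal.ofReal
        (r ^ (l - n) * (1 + d * r ^ (l * k)) ^ (-(1 / k + 1))) ^ p * ENNReal.ofReal (r ^ γ))
      (by positivity) (by linarith) hd0 (by positivity) (by rw [hγl]; field_simp; ring)
      (by fun_prop) fun r hr ↦ ?_
    rw [ENNReal.ofReal_rpow_of_pos (by positivity), ← ENNReal.ofReal_mul (by positivity),
      Real.mul_rpow (by positivity) (by positivity), ← Real.rpow_mul hr.le,
      ← Real.rpow_mul (by positivity), Real.rpow_add hr,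
      show 1 / k + (q / k - 1 / k - 1 + 1) = q / k by ring,
      show -(1 / k + 1) * p = -(q / k) by rw [hqk]; field_simp; ring]
    congr 1
    ring
  have hB := ProbabilityTheory.beta_pos (one_div_pos.2 hk0) (show 0 < q / k - 1 / k - 1 + 1 by linarith)
  rw [hLHS, hRHS, beta_add_one_left (by positivity) hb1, ENNReal.ofReal_rpow_of_pos (by positivity),
    ENNReal.ofReal_rpow_of_pos (by positivity),
    ← ENNReal.ofReal_mul (sharpFactor_pos hn hp hpq hγ).le]
  congr 1
  have e1 : p / (q - p) = 1 / k := by rw [hk]; field_simp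
  have e2 : p * q / (q / (q - 1) * (q - p)) = q / k - 1 / k - 1 + 1 := by
    rw [hk]
    field_simp
    ring
  have e3 : 1 / k / (q / k - 1 / k - 1) = p / (p - 1) / q := by
    have : q / k - 1 / k - 1 = q * (p - 1) / (q - p) := by
      rw [hk]
      field_simp
      ring
    rw [this, hk]
    field_simp
  rw [sharpFactor, e1, e2, e3, betaFn_eq_beta (by positivity) (by linarith), hnl, hC, hd]
  set B := ProbabilityTheory.beta (1 / k) (q / k - 1 / k - 1 + 1)
  refine Real.log_injOn_pos (mem_Ioi.2 (by positivity)) (mem_Ioi.2 (by positivity)) ?_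
  have hP : 0 < p / (p - 1) / q := by positivity
  generalize p / (p - 1) / q = P at hP ⊢
  generalize omegaN n = ω at hω ⊢
  clear_value B
  simp (disch := positivity) only [Real.log_mul, Real.log_rpow, Real.log_div,
    Real.log_inv, Real.log_one]
  rw [hqk]
  field_simp
  ring

/-- The explicit extremal function attains the sharp constant of the weighted
product-space Hardy inequality on `ℝ^{n₁} × ℝ^{n₂}`. -/
theorem weighted_prodFracHardy₂_extremal (n₁ n₂ : ℕ) (hn₁ : 1 ≤ n₁) (hn₂ : 1 ≤ n₂)
    (β₁ β₂ α₁ α₂ γ₁ γ₂ p q : ℝ) (hp : 1 < p) (hpq : p < q)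
    (hβ₁0 : 0 ≤ β₁) (hβ₁n : β₁ < n₁) (hβ₂0 : 0 ≤ β₂) (hβ₂n : β₂ < n₂)
    (hγ₁ : γ₁ < n₁ * (p - 1)) (hγ₂ : γ₂ < n₂ * (p - 1))
    (hscal₁ : β₁ + (α₁ + n₁) / q = (γ₁ + n₁) / p)
    (hscal₂ : β₂ + (α₂ + n₂) / q = (γ₂ + n₂) / p)
    (f : EuclideanSpace ℝ (Fin n₁) × EuclideanSpace ℝ (Fin n₂) → ℝ≥0∞)
    (hf : ∀ x, f x = ENNReal.ofReal
      ((‖x.1‖ ^ (-γ₁ / (p - 1)) *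
          (1 + ((n₁ * (p - 1)) / (n₁ * (p - 1) - γ₁)) ^ (1 / (n₁ : ℝ)) *
            ‖x.1‖ ^ (((n₁ * (p - 1) - γ₁) / (n₁ * (p - 1))) * ((n₁ : ℝ) * q / p - n₁))) ^
            (-(q / (q - p)))) *
        (‖x.2‖ ^ (-γ₂ / (p - 1)) *
          (1 + ((n₂ * (p - 1)) / (n₂ * (p - 1) - γ₂)) ^ (1 / (n₂ : ℝ)) *
            ‖x.2‖ ^ (((n₂ * (p - 1) - γ₂) / (n₂ * (p - 1))) * ((n₂ : ℝ) * q / p - n₂))) ^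
            (-(q / (q - p)))))) :
    (∫⁻ x, prodFracHardy₂ n₁ n₂ β₁ β₂ f x ^ q *
        ENNReal.ofReal (‖x.1‖ ^ α₁ * ‖x.2‖ ^ α₂)) ^ (1 / q)
      = ENNReal.ofReal (sharpFactor n₁ β₁ γ₁ p q * sharpFactor n₂ β₂ γ₂ p q) *
        (∫⁻ x, f x ^ p * ENNReal.ofReal (‖x.1‖ ^ γ₁ * ‖x.2‖ ^ γ₂)) ^ (1 / p) := by
  have hmeas : ∀ (n : ℕ) (γ : ℝ), Measurable fun y : EuclideanSpace ℝ (Fin n) ↦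
      ENNReal.ofReal (hardyExtremalProfile n γ p q ‖y‖) := by
    intro n γ
    unfold hardyExtremalProfile
    fun_prop
  have hq0 : 0 < q := by linarith
  have hp0 : 0 < p := by linarith
  have hnonneg : ∀ (n : ℕ) (γ r : ℝ), γ < n * (p - 1) → 0 ≤ r →
      0 ≤ hardyExtremalProfile n γ p q r := by
    intro n γ r hγ hr
    have h1 : 0 < p - 1 := by linarith
    have h2 : 0 < n * (p - 1) - γ := by linarith
    unfold hardyExtremalProfile
    positivity
  have hf' : f = fun x ↦ ENNReal.ofReal (hardyExtremalProfile n₁ γ₁ p q ‖x.1‖) *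
      ENNReal.ofReal (hardyExtremalProfile n₂ γ₂ p q ‖x.2‖) := by
    funext x
    rw [hf, ← ENNReal.ofReal_mul (hnonneg _ _ _ hγ₁ (norm_nonneg _))]
    rfl
  have hL : ∀ x, prodFracHardy₂ n₁ n₂ β₁ β₂ f x ^ q *
        ENNReal.ofReal (‖x.1‖ ^ α₁ * ‖x.2‖ ^ α₂) =
      (fracHardy n₁ β₁ (fun y ↦ ENNReal.ofReal (hardyExtremalProfile n₁ γ₁ p q ‖y‖)) x.1 ^ q *
        ENNReal.ofReal (‖x.1‖ ^ α₁)) *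
      (fracHardy n₂ β₂ (fun y ↦ ENNReal.ofReal (hardyExtremalProfile n₂ γ₂ p q ‖y‖)) x.2 ^ q *
        ENNReal.ofReal (‖x.2‖ ^ α₂)) := by
    intro x
    rw [hf', prodFracHardy₂_mul β₁ β₂ (hmeas _ _) (hmeas _ _),
      ENNReal.mul_rpow_of_nonneg _ _ hq0.le, ENNReal.ofReal_mul (by positivity)]
    ring
  have hR : ∀ x, f x ^ p * ENNReal.ofReal (‖x.1‖ ^ γ₁ * ‖x.2‖ ^ γ₂) =
      (ENNReal.ofReal (hardyExtremalProfile n₁ γ₁ p q ‖x.1‖) ^ p * ENNReal.ofReal (‖x.1‖ ^ γ₁)) *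
      (ENNReal.ofReal (hardyExtremalProfile n₂ γ₂ p q ‖x.2‖) ^ p *
        ENNReal.ofReal (‖x.2‖ ^ γ₂)) := by
    intro x
    rw [hf', ENNReal.mul_rpow_of_nonneg _ _ hp0.le, ENNReal.ofReal_mul (by positivity)]
    ring
  have hmL : ∀ (n : ℕ) (β γ α : ℝ), Measurable fun x ↦
      fracHardy n β (fun y ↦ ENNReal.ofReal (hardyExtremalProfile n γ p q ‖y‖)) x ^ q *
        ENNReal.ofReal (‖x‖ ^ α) := fun n β γ α ↦
    ((measurable_fracHardy n β _).pow_const q).mul (by fun_prop)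
  have hmR : ∀ (n : ℕ) (γ : ℝ), Measurable fun x : EuclideanSpace ℝ (Fin n) ↦
      ENNReal.ofReal (hardyExtremalProfile n γ p q ‖x‖) ^ p * ENNReal.ofReal (‖x‖ ^ γ) :=
    fun n γ ↦ ((hmeas n γ).pow_const p).mul (by fun_prop)
  simp_rw [hL, hR]
  rw [Measure.volume_eq_prod, lintegral_prod_mul (hmL _ _ _ _).aemeasurable
    (hmL _ _ _ _).aemeasurable, lintegral_prod_mul (hmR _ _).aemeasurable (hmR _ _).aemeasurable,
    ENNReal.mul_rpow_of_nonneg _ _ (by positivity), ENNReal.mul_rpow_of_nonneg _ _ (by positivity),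
    fracHardy_hardyExtremalProfile hn₁ hp hpq hγ₁ hscal₁,
    fracHardy_hardyExtremalProfile hn₂ hp hpq hγ₂ hscal₂,
    ENNReal.ofReal_mul (sharpFactor_pos hn₁ hp hpq hγ₁).le]
  ring
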